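/- Fix positive integers t ≤ m ≤ n, let X be an m×n matrix of indeterminates over a field 𝔽 of prime characteristic, R = 𝔽[X], and I_t the ideal of t×t minors of X. Let s be a positive integer and let δ_1, …, δ_h be minors of X (of arbitrary sizes). If h ≤ s and the sum of the degrees of the δ_i (i.e., the sum of their sizes) equals ts, then the product δ_1⋯δ_h lies in the integral closure of the ideal I_t^s. -/

import Mathlib

open MvPolynomial

/-- The generic `m × n` matrix `X`, whose entries are the variables `x_{ij}` of the
polynomial ring `𝔽[X]`. -/
noncomputable def genMat (𝔽 : Type*) [Field 𝔽] (m n : ℕ) :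
    Matrix (Fin m) (Fin n) (MvPolynomial (Fin m × Fin n) 𝔽) :=
  Matrix.of fun i j => MvPolynomial.X (i, j)

/-- `f` is a size `s` minor of the generic `m × n` matrix: the determinant of the submatrix
obtained by choosing `s` rows and `s` columns (in increasing order). -/
def IsMinor (𝔽 : Type*) [Field 𝔽] (m n s : ℕ) (f : MvPolynomial (Fin m × Fin n) 𝔽) : Prop :=
  ∃ (row : Fin s → Fin m) (col : Fin s → Fin n), StrictMono row ∧ StrictMono col ∧
    f = ((genMat 𝔽 m n).submatrix row col).det

/-- `I_s ⊆ 𝔽[X]`, the ideal generated by the size `s` minors of the generic matrix. -/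
noncomputable def minorsIdeal (𝔽 : Type*) [Field 𝔽] (m n s : ℕ) :
    Ideal (MvPolynomial (Fin m × Fin n) 𝔽) :=
  Ideal.span {f | IsMinor 𝔽 m n s f}

/-- `x` lies in the integral closure of the ideal `J`: it satisfies an equation
`x^d + a_1 x^{d-1} + ⋯ + a_d = 0` with `a_i ∈ J^i`. -/
def MemIntClosure {R : Type*} [CommRing R] (J : Ideal R) (x : R) : Prop :=
  ∃ (d : ℕ) (a : ℕ → R), 0 < d ∧ (∀ i ∈ Finset.Icc 1 d, a i ∈ J ^ i) ∧
    x ^ d + ∑ i ∈ Finset.Icc 1 d, a i * x ^ (d - i) = 0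

theorem memIntClosure_of_forall_valuationSubring {R K : Type*} [CommRing R] [Field K] [Algebra R K]
    (hinj : Function.Injective (algebraMap R K)) (J : Ideal R) (x : R)
    (H : ∀ (V : ValuationSubring K) (φ : R →+* V), (∀ r, (φ r : K) = algebraMap R K r) →
      φ x ∈ J.map φ) : MemIntClosure J x := by
  by_cases hx : x = 0
  · exact ⟨1, 0, one_pos, fun i _ => zero_mem _, by simp [hx]⟩
  have hx' : algebraMap R K x ≠ 0 := by simpa using hinj.ne hx
  let ψ : reesAlgebra J →+* K :=
    ((Polynomial.aeval (algebraMap R K x)⁻¹).comp (reesAlgebra J).val).toRingHom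
  have hψ : ∀ f, ψ f = Polynomial.aeval (algebraMap R K x)⁻¹ (f : Polynomial R) := fun f => rfl
  let P : Ideal (reesAlgebra J) :=
    RingHom.ker ((Polynomial.constantCoeff (R := R)).comp (reesAlgebra J).val.toRingHom)
  have hP : ∀ f, f ∈ P ↔ (f : Polynomial R).coeff 0 = 0 := fun f => Iff.rfl
  by_cases hI : P.map ψ.rangeRestrict = ⊤
  · obtain ⟨f, hfP, hf⟩ := (Ideal.mem_map_iff_of_surjective _ ψ.rangeRestrict_surjective).1
      ((Ideal.eq_top_iff_one _).1 hI)
    have hf1 : ψ f = 1 := congrArg Subtype.val hf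
    set d := (f : Polynomial R).natDegree + 1 with hd
    refine ⟨d, fun i => -(f : Polynomial R).coeff i, Nat.succ_pos _,
      fun i _ => neg_mem (f.2 i), hinj ?_⟩
    rw [hψ, Polynomial.aeval_eq_sum_range' (n := d + 1) (by omega), Finset.sum_range_succ',
      (hP f).1 hfP, zero_smul, add_zero] at hf1
    have key : ∀ i ∈ Finset.range d, algebraMap R K x ^ d *
        ((f : Polynomial R).coeff (i + 1) • (algebraMap R K x)⁻¹ ^ (i + 1)) =
        algebraMap R K ((f : Polynomial R).coeff (1 + i) * x ^ (d - (1 + i))) := by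
      intro i hi
      have hi' := Finset.mem_range.1 hi
      rw [Algebra.smul_def, map_mul, map_pow, add_comm i 1,
        ← Nat.add_sub_cancel' (n := d) (m := 1 + i) (by omega), pow_add, Nat.add_sub_cancel_left, inv_pow]
      field_simp
    have := congrArg (algebraMap R K x ^ d * ·) hf1
    simp only [Finset.mul_sum, mul_one] at this
    rw [Finset.sum_congr rfl key, ← map_sum, ← map_pow] at this
    rw [map_add, ← this, ← map_add, ← Finset.Ico_add_one_right_eq_Icc, Finset.sum_Ico_eq_sum_range]
    simp
  · exfalso
    obtain ⟨V, hAV, hPV⟩ := Ideal.image_subset_nonunits_valuationSubring _ hI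
    have hmem : ∀ r, algebraMap R K r ∈ V := fun r =>
      hAV ⟨algebraMap R (reesAlgebra J) r, by simp [hψ]⟩
    let φ : R →+* V := (algebraMap R K).codRestrict V hmem
    have hφ : ∀ r, (φ r : K) = algebraMap R K r := fun r => rfl
    have hJ : J.map φ ≤ Ideal.span {φ x} * IsLocalRing.maximalIdeal V := by
      rw [Ideal.map_le_iff_le_comap]
      intro j hj
      let f : reesAlgebra J := ⟨Polynomial.monomial 1 j, reesAlgebra.monomial_mem.2 (by simpa)⟩
      have hf : ψ f = algebraMap R K j * (algebraMap R K x)⁻¹ := by simp [hψ, f]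
      have hfV : ψ f ∈ V.nonunits :=
        hPV ⟨ψ.rangeRestrict f, Ideal.mem_map_of_mem _ ((hP f).2 (by
          simp [f, Polynomial.coeff_monomial])), rfl⟩
      obtain ⟨h1, h2⟩ := ValuationSubring.mem_nonunits_iff_exists_mem_maximalIdeal.1 hfV
      rw [Ideal.mem_comap, Ideal.mem_span_singleton_mul]
      refine ⟨_, h2, Subtype.ext ?_⟩
      simp [hφ, hf]
      field_simp
    obtain ⟨z, hz, hxz⟩ := Ideal.mem_span_singleton_mul.1 (hJ (H V φ hφ))
    have hφx : φ x ≠ 0 := fun h => hx' (by rw [← hφ, h]; rfl)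
    have : z = 1 := mul_left_cancel₀ hφx (by simpa using hxz)
    exact (IsLocalRing.mem_maximalIdeal _).1 hz (this ▸ isUnit_one)

namespace Matrix

/-- Each of the two matrices is obtained from the other by left and right multiplication. -/
def MulEquivalent {m n V : Type*} [Fintype m] [Fintype n] [CommRing V] (A B : Matrix m n V) :
    Prop :=
  (∃ (P : Matrix m m V) (Q : Matrix n n V), B = P * A * Q) ∧
    ∃ (P : Matrix m m V) (Q : Matrix n n V), A = P * B * Q

theorem MulEquivalent.refl {m n V : Type*} [Fintype m] [Fintype n] [CommRing V]
    (A : Matrix m n V) : MulEquivalent A A := by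
  classical exact ⟨⟨1, 1, by simp⟩, ⟨1, 1, by simp⟩⟩

theorem MulEquivalent.trans {m n V : Type*} [Fintype m] [Fintype n] [CommRing V]
    {A B C : Matrix m n V} (h₁ : MulEquivalent A B) (h₂ : MulEquivalent B C) :
    MulEquivalent A C := by
  obtain ⟨⟨P, Q, rfl⟩, P', Q', h₁⟩ := h₁
  obtain ⟨⟨R, S, rfl⟩, R', S', h₂⟩ := h₂
  refine ⟨⟨R * P, Q * S, by simp only [Matrix.mul_assoc]⟩, P' * R', S' * Q', ?_⟩
  conv_lhs => rw [h₁, h₂]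
  simp only [Matrix.mul_assoc]

theorem mulEquivalent_submatrix {m n V : Type*} [Fintype m] [Fintype n] [CommRing V]
    (A : Matrix m n V) (e : Equiv.Perm m) (f : Equiv.Perm n) :
    MulEquivalent A (A.submatrix e f) := by
  classical
  have h : ∀ (A : Matrix m n V) (e : Equiv.Perm m) (f : Equiv.Perm n),
      ∃ (P : Matrix m m V) (Q : Matrix n n V), A.submatrix e f = P * A * Q := fun A e f =>
    ⟨(1 : Matrix m m V).submatrix e (Equiv.refl m), (1 : Matrix n n V).submatrix (Equiv.refl n) f, by
      ext; simp [Matrix.mul_apply, Matrix.one_apply]⟩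
  exact ⟨h A e f, by simpa using h (A.submatrix e f) e.symm f.symm⟩

/-- The block diagonal matrix with blocks `a` (of size one) and `B`. -/
def consDiag {V : Type*} [Zero V] {m n : ℕ} (a : V) (B : Matrix (Fin m) (Fin n) V) :
    Matrix (Fin (m + 1)) (Fin (n + 1)) V :=
  Matrix.of (Fin.cons (Fin.cons a 0) fun i => Fin.cons 0 (B i))

theorem consDiag_mul_consDiag {V : Type*} [CommRing V] {l m n : ℕ} (a b : V)
    (A : Matrix (Fin l) (Fin m) V) (B : Matrix (Fin m) (Fin n) V) :
    consDiag a A * consDiag b B = consDiag (a * b) (A * B) := by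
  ext i j
  cases i using Fin.cases <;> cases j using Fin.cases <;>
    simp [consDiag, Matrix.mul_apply, Fin.sum_univ_succ]

theorem MulEquivalent.consDiag {V : Type*} [CommRing V] {m n : ℕ} (a : V)
    {A B : Matrix (Fin m) (Fin n) V} (h : MulEquivalent A B) :
    MulEquivalent (consDiag a A) (consDiag a B) := by
  obtain ⟨⟨P, Q, h₁⟩, P', Q', h₂⟩ := h
  exact ⟨⟨Matrix.consDiag 1 P, Matrix.consDiag 1 Q, by simp [consDiag_mul_consDiag, ← h₁]⟩,
    Matrix.consDiag 1 P', Matrix.consDiag 1 Q', by simp [consDiag_mul_consDiag, ← h₂]⟩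

theorem exists_mulEquivalent_consDiag {V : Type*} [CommRing V] {m n : ℕ}
    (A : Matrix (Fin (m + 1)) (Fin (n + 1)) V) (hA : ∀ i j, A 0 0 ∣ A i j) :
    ∃ B : Matrix (Fin m) (Fin n) V, (∀ i j, A 0 0 ∣ B i j) ∧
      MulEquivalent A (consDiag (A 0 0) B) := by
  choose x hx using fun i : Fin m => hA i.succ 0
  choose y hy using fun j : Fin n => hA 0 j.succ
  let low : (Fin m → V) → Matrix (Fin (m + 1)) (Fin (m + 1)) V := fun x =>
    Matrix.of (Fin.cons (Fin.cons 1 0) fun i => Fin.cons (x i) ((1 : Matrix (Fin m) (Fin m) V) i))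
  let upp : (Fin n → V) → Matrix (Fin (n + 1)) (Fin (n + 1)) V := fun y =>
    Matrix.of (Fin.cons (Fin.cons 1 y) fun i => Fin.cons 0 ((1 : Matrix (Fin n) (Fin n) V) i))
  refine ⟨Matrix.of fun i j => A i.succ j.succ - A 0 0 * x i * y j, fun i j =>
    dvd_sub (hA _ _) (Dvd.intro _ (mul_assoc _ _ _).symm),
    ⟨low (-x), upp (-y), ?_⟩, low x, upp y, ?_⟩ <;>
  · ext i j
    cases i using Fin.cases <;> cases j using Fin.cases <;>
      simp [consDiag, low, upp, Matrix.mul_apply, Fin.sum_univ_succ, Matrix.one_apply, hx, hy] <;>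
      ring

/-- The rectangular matrix with diagonal entries `d 0, d 1, …`. -/
def rectDiag {V : Type*} [Zero V] (m n : ℕ) (d : ℕ → V) : Matrix (Fin m) (Fin n) V :=
  Matrix.of fun i j => if (i : ℕ) = j then d i else 0

theorem exists_dvd_of_forall_entry {V ι : Type*} [CommRing V] [IsDomain V] [ValuationRing V]
    [Finite ι] [Nonempty ι] (f : ι → V) : ∃ i, ∀ j, f i ∣ f j := by
  have hf : Directed (fun a b => b ∣ a) f := fun i j =>
    (ValuationRing.dvd_total (f i) (f j)).elim (fun h => ⟨i, dvd_rfl, h⟩) fun h => ⟨j, h, dvd_rfl⟩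
  have : IsTrans V fun a b => b ∣ a := ⟨fun _ _ _ h₁ h₂ => h₂.trans h₁⟩
  exact hf.finite_le id

theorem dvd_mul_apply {V : Type*} [CommRing V] {k l m n : Type*} [Fintype m] [Fintype l] {a : V}
    (A : Matrix l m V) (hA : ∀ i j, a ∣ A i j) (P : Matrix k l V) (Q : Matrix m n V) (i : k) (j : n) :
    a ∣ (P * A * Q) i j := by
  simp only [Matrix.mul_apply]
  exact Finset.dvd_sum fun _ _ => Dvd.dvd.mul_right
    (Finset.dvd_sum fun _ _ => Dvd.dvd.mul_left (hA _ _) _) _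

/-- Smith normal form over a valuation ring. -/
theorem exists_mulEquivalent_rectDiag {V : Type*} [CommRing V] [IsDomain V] [ValuationRing V]
    {m n : ℕ} (A : Matrix (Fin m) (Fin n) V) :
    ∃ d : ℕ → V, (∀ i, d i ∣ d (i + 1)) ∧ MulEquivalent A (rectDiag m n d) := by
  induction m generalizing n with
  | zero => exact ⟨0, by simp, by convert MulEquivalent.refl A; ext i; exact i.elim0⟩
  | succ m ih =>
    cases n with
    | zero => exact ⟨0, by simp, by convert MulEquivalent.refl A; ext i j; exact j.elim0⟩
    | succ n =>
      obtain ⟨⟨p, q⟩, hpq⟩ := exists_dvd_of_forall_entry fun ij : Fin (m + 1) × Fin (n + 1) =>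
        A ij.1 ij.2
      have h₁ := mulEquivalent_submatrix A (Equiv.swap 0 p) (Equiv.swap 0 q)
      set A' := A.submatrix (Equiv.swap 0 p) (Equiv.swap 0 q) with hA'
      have ha : ∀ i j, A' 0 0 ∣ A' i j := fun i j => by
        simpa [hA'] using hpq (Equiv.swap 0 p i, Equiv.swap 0 q j)
      obtain ⟨B, hB, h₂⟩ := exists_mulEquivalent_consDiag A' ha
      obtain ⟨d, hd, h₃⟩ := ih B
      set a := A' 0 0
      have h₄ := h₁.trans (h₂.trans (h₃.consDiag a))
      obtain ⟨⟨P, Q, hPQ⟩, -⟩ := h₃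
      have hdiag : ∀ i j, a ∣ rectDiag m n d i j := fun i j => hPQ ▸ dvd_mul_apply B hB P Q i j
      by_cases hmn : 0 < m ∧ 0 < n
      · refine ⟨fun i => Nat.casesOn i a d, ?_, ?_⟩
        · rintro (_ | i)
          · simpa [rectDiag] using hdiag ⟨0, hmn.1⟩ ⟨0, hmn.2⟩
          · exact hd i
        · convert h₄ using 1
          ext i j
          cases i using Fin.cases <;> cases j using Fin.cases <;> simp [rectDiag, Matrix.consDiag]
      · refine ⟨fun i => Nat.casesOn i a 0, ?_, ?_⟩
        · rintro (_ | i) <;> simp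
        · convert h₄ using 1
          ext i j
          cases i using Fin.cases <;> cases j using Fin.cases <;> simp [rectDiag, Matrix.consDiag]
          exact absurd ⟨Fin.pos ‹_›, Fin.pos ‹_›⟩ hmn

end Matrix

namespace Matrix

/-- The ideal generated by the determinants of the `k × k` submatrices of `A`, where rows and
columns may be repeated and listed in any order. -/
def detIdeal {m n V : Type*} [CommRing V] (k : ℕ) (A : Matrix m n V) : Ideal V :=
  Ideal.span (Set.range fun rc : (Fin k → m) × (Fin k → n) => (A.submatrix rc.1 rc.2).det)

theorem det_submatrix_mem_detIdeal {m n V : Type*} [CommRing V] {k : ℕ} (A : Matrix m n V)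
    (r : Fin k → m) (c : Fin k → n) : (A.submatrix r c).det ∈ detIdeal k A :=
  Ideal.subset_span ⟨(r, c), rfl⟩

theorem detIdeal_le_iff {m n V : Type*} [CommRing V] {k : ℕ} {A : Matrix m n V} {I : Ideal V} :
    detIdeal k A ≤ I ↔ ∀ (r : Fin k → m) (c : Fin k → n), (A.submatrix r c).det ∈ I := by
  rw [detIdeal, Ideal.span_le, Set.range_subset_iff, Prod.forall]
  rfl

theorem detIdeal_transpose_le {m n V : Type*} [CommRing V] (k : ℕ) (A : Matrix m n V) :
    detIdeal k Aᵀ ≤ detIdeal k A :=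
  detIdeal_le_iff.2 fun r c => by
    rw [← det_transpose, transpose_submatrix, transpose_transpose]
    exact det_submatrix_mem_detIdeal A c r

theorem detIdeal_mul_left_le {l m n V : Type*} [Fintype m] [CommRing V] (k : ℕ)
    (P : Matrix l m V) (A : Matrix m n V) : detIdeal k (P * A) ≤ detIdeal k A := by
  classical
  refine detIdeal_le_iff.2 fun r c => ?_
  have h : (P * A).submatrix r c = fun i => ∑ x, P (r i) x • fun j => A x (c j) := by
    ext i j
    simp [Matrix.mul_apply]
  rw [h]
  change (detRowAlternating : (Fin k → V) [⋀^Fin k]→ₗ[V] V).toMultilinearMap _ ∈ _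
  rw [MultilinearMap.map_sum]
  refine sum_mem fun f _ => ?_
  rw [MultilinearMap.map_smul_univ]
  exact Ideal.mul_mem_left _ _ (det_submatrix_mem_detIdeal A f c)

theorem detIdeal_mul_right_le {l m n V : Type*} [Fintype n] [CommRing V] (k : ℕ)
    (A : Matrix m n V) (Q : Matrix n l V) : detIdeal k (A * Q) ≤ detIdeal k A := by
  rw [← transpose_transpose (A * Q), transpose_mul]
  exact (detIdeal_transpose_le k _).trans
    ((detIdeal_mul_left_le k _ _).trans (detIdeal_transpose_le k A))

theorem MulEquivalent.detIdeal_eq {m n V : Type*} [Fintype m] [Fintype n] [CommRing V]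
    {A B : Matrix m n V} (h : MulEquivalent A B) (k : ℕ) : detIdeal k A = detIdeal k B := by
  have key : ∀ (A : Matrix m n V) (P : Matrix m m V) (Q : Matrix n n V),
      detIdeal k (P * A * Q) ≤ detIdeal k A := fun A P Q =>
    (detIdeal_mul_right_le k _ Q).trans (detIdeal_mul_left_le k P A)
  obtain ⟨⟨P, Q, h₁⟩, P', Q', h₂⟩ := h
  exact le_antisymm (h₂ ▸ key B P' Q') (h₁ ▸ key A P Q)

theorem prod_range_dvd_prod_of_injective {V : Type*} [CommRing V] {d : ℕ → V}
    (hd : ∀ i j, i ≤ j → d i ∣ d j) {k : ℕ} (c : Fin k → ℕ) (hc : Function.Injective c) :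
    ∏ i ∈ Finset.range k, d i ∣ ∏ i, d (c i) := by
  have hmono : StrictMono (c ∘ Tuple.sort c) :=
    (Tuple.monotone_sort c).strictMono_of_injective (hc.comp (Equiv.injective _))
  rw [← Equiv.prod_comp (Tuple.sort c), ← Fin.prod_univ_eq_prod_range]
  refine Finset.prod_dvd_prod_of_dvd _ _ fun i _ => hd _ _ ?_
  clear * - hmono
  obtain ⟨i, hi⟩ := i
  induction i with
  | zero => exact Nat.zero_le _
  | succ i ih => exact (ih (by omega)).trans_lt (hmono (Fin.mk_lt_mk.2 i.lt_succ_self))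

theorem prod_dvd_det_submatrix_rectDiag {V : Type*} [CommRing V] {m n k : ℕ} {d : ℕ → V}
    (hd : ∀ i j, i ≤ j → d i ∣ d j) (r : Fin k → Fin m) (c : Fin k → Fin n) :
    ∏ i ∈ Finset.range k, d i ∣ ((rectDiag m n d).submatrix r c).det := by
  by_cases hr : Function.Injective r
  · rw [det_apply']
    refine Finset.dvd_sum fun σ _ => Dvd.dvd.mul_left ?_ _
    by_cases h : ∀ i, (r (σ i) : ℕ) = c i
    · simp_rw [submatrix_apply, rectDiag, of_apply, if_pos (h _)]
      exact prod_range_dvd_prod_of_injective hd (fun i => (r (σ i) : ℕ))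
        (Fin.val_injective.comp (hr.comp σ.injective))
    · push Not at h
      obtain ⟨i, hi⟩ := h
      rw [Finset.prod_eq_zero (Finset.mem_univ i) (by simp [rectDiag, hi])]
      exact dvd_zero _
  · simp only [Function.Injective, not_forall] at hr
    obtain ⟨i, j, hij, hne⟩ := hr
    rw [det_zero_of_row_eq hne (by ext; simp [hij])]
    exact dvd_zero _

theorem prod_mem_detIdeal_rectDiag {V : Type*} [CommRing V] {m n k : ℕ} (hm : k ≤ m) (hn : k ≤ n)
    (d : ℕ → V) : ∏ i ∈ Finset.range k, d i ∈ detIdeal k (rectDiag m n d) := by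
  have h : (rectDiag m n d).submatrix (Fin.castLE hm) (Fin.castLE hn) =
      Matrix.diagonal fun i : Fin k => d i := by
    ext i j
    simp [rectDiag, diagonal_apply, Fin.ext_iff]
  rw [← Fin.prod_univ_eq_prod_range, ← det_diagonal, ← h]
  exact det_submatrix_mem_detIdeal _ _ _

end Matrix

theorem det_submatrix_genMat_mem_minorsIdeal (𝔽 : Type*) [Field 𝔽] {m n t : ℕ}
    (r : Fin t → Fin m) (c : Fin t → Fin n) :
    ((genMat 𝔽 m n).submatrix r c).det ∈ minorsIdeal 𝔽 m n t := by
  by_cases hr : Function.Injective r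
  · by_cases hc : Function.Injective c
    · have hr' := (Tuple.monotone_sort r).strictMono_of_injective (hr.comp (Equiv.injective _))
      have hc' := (Tuple.monotone_sort c).strictMono_of_injective (hc.comp (Equiv.injective _))
      have key : ((genMat 𝔽 m n).submatrix (r ∘ Tuple.sort r) (c ∘ Tuple.sort c)).det ∈
          minorsIdeal 𝔽 m n t := Ideal.subset_span ⟨_, _, hr', hc', rfl⟩
      have h : (genMat 𝔽 m n).submatrix (r ∘ Tuple.sort r) (c ∘ Tuple.sort c) =
          (((genMat 𝔽 m n).submatrix r c).submatrix (Tuple.sort r) id).submatrix id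
            (Tuple.sort c) := rfl
      rw [h, Matrix.det_permute', Matrix.det_permute] at key
      have hu : ∀ ε : ℤˣ, IsUnit ((ε : ℤ) : MvPolynomial (Fin m × Fin n) 𝔽) := fun ε =>
        ε.isUnit.map (Int.castRingHom _)
      rw [Ideal.unit_mul_mem_iff_mem _ (hu _), Ideal.unit_mul_mem_iff_mem _ (hu _)] at key
      exact key
    · simp only [Function.Injective, not_forall] at hc
      obtain ⟨i, j, hij, hne⟩ := hc
      rw [Matrix.det_zero_of_column_eq hne (by simp [hij])]
      exact zero_mem _
  · simp only [Function.Injective, not_forall] at hr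
    obtain ⟨i, j, hij, hne⟩ := hr
    rw [Matrix.det_zero_of_row_eq hne (by ext; simp [hij])]
    exact zero_mem _

/-- Discrete Jensen inequality for the convex sequence of partial products of a divisor chain. -/
theorem pow_prod_range_dvd_prod {V : Type*} [CommRing V] [IsDomain V] {d : ℕ → V}
    (hd : ∀ i j, i ≤ j → d i ∣ d j) {t s h : ℕ} (ht : 0 < t) (hs : 0 < s) (hhs : h ≤ s)
    (k : Fin h → ℕ) (hk : ∑ i, k i = t * s) :
    (∏ j ∈ Finset.range t, d j) ^ s ∣ ∏ i, ∏ j ∈ Finset.range (k i), d j := by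
  obtain ⟨t, rfl⟩ : ∃ u, t = u + 1 := ⟨t - 1, by omega⟩
  set D : ℕ → V := fun k => ∏ j ∈ Finset.range k, d j with hD
  change D (t + 1) ^ s ∣ ∏ i, D (k i)
  have tangent : ∀ a, D (t + 1) * d t ^ a ∣ D a * d t ^ (t + 1) := by
    intro a
    rcases le_total a (t + 1) with ha | ha
    · obtain ⟨b, hb⟩ := Nat.exists_eq_add_of_le ha
      have : ∏ j ∈ Finset.range b, d (a + j) ∣ ∏ j ∈ Finset.range b, d t :=
        Finset.prod_dvd_prod_of_dvd _ _ fun j hj => hd _ _ (by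
          have := Finset.mem_range.1 hj; omega)
      rw [Finset.prod_const, Finset.card_range] at this
      simp only [hD, hb, Finset.prod_range_add, pow_add, mul_assoc]
      rw [mul_comm (d t ^ a)]
      exact mul_dvd_mul_left _ (mul_dvd_mul_right this _)
    · obtain ⟨b, rfl⟩ := Nat.exists_eq_add_of_le ha
      have : ∏ j ∈ Finset.range b, d t ∣ ∏ j ∈ Finset.range b, d (t + 1 + j) :=
        Finset.prod_dvd_prod_of_dvd _ _ fun j hj => hd _ _ (by omega)
      rw [Finset.prod_const, Finset.card_range] at this
      simp only [hD]
      rw [Finset.prod_range_add d (t + 1), pow_add _ _ b, mul_assoc, mul_comm (d t ^ (t + 1))]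
      exact mul_dvd_mul_left _ (mul_dvd_mul_right this _)
  by_cases h0 : d t = 0
  · obtain ⟨i, hi⟩ : ∃ i, t + 1 ≤ k i := by
      by_contra! hlt
      have h₁ : ∑ i, k i ≤ h * t := by
        simpa using Finset.sum_le_card_nsmul Finset.univ k t fun i _ => Nat.lt_succ_iff.1 (hlt i)
      nlinarith [Nat.mul_le_mul_right t hhs]
    rw [Finset.prod_eq_zero (Finset.mem_univ i)
      (Finset.prod_eq_zero (Finset.mem_range.2 (Nat.lt_of_succ_le hi)) h0)]
    exact dvd_zero _
  · have h₁ := Finset.prod_dvd_prod_of_dvd _ _ fun i (_ : i ∈ Finset.univ) => tangent (k i)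
    rw [Finset.prod_mul_distrib, Finset.prod_mul_distrib, Finset.prod_pow_eq_pow_sum, hk,
      Finset.prod_const, Finset.prod_const, Finset.card_univ, Fintype.card_fin] at h₁
    have h₂ : D (t + 1) ∣ d t ^ (t + 1) := by simpa [hD] using tangent 0
    have h₃ := mul_dvd_mul h₁ (pow_dvd_pow_of_dvd h₂ (s - h))
    refine (mul_dvd_mul_iff_right (pow_ne_zero ((t + 1) * s) h0)).1 ?_
    convert h₃ using 1
    · rw [← Nat.add_sub_cancel' hhs, pow_add, Nat.add_sub_cancel_left, Nat.add_sub_cancel' hhs]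
      ring
    · rw [mul_assoc, ← pow_add, Nat.add_sub_cancel' hhs, ← pow_mul]

/-- **(Bruns)** If `δ_1, …, δ_h` are minors of the generic `m × n` matrix with `h ≤ s` and
total degree (sum of sizes) equal to `ts`, then `δ_1 ⋯ δ_h` lies in the integral closure
of `I_t^s`. -/
theorem prod_minors_mem_integralClosure_pow (p : ℕ) (hp : p.Prime)
    (𝔽 : Type*) [Field 𝔽] [CharP 𝔽 p]
    (m n t : ℕ) (ht : 0 < t) (htm : t ≤ m) (hmn : m ≤ n)
    (s : ℕ) (hs : 0 < s) (h : ℕ) (hhs : h ≤ s)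
    (sz : Fin h → ℕ) (δ : Fin h → MvPolynomial (Fin m × Fin n) 𝔽)
    (hminor : ∀ i, IsMinor 𝔽 m n (sz i) (δ i))
    (hdeg : ∑ i, sz i = t * s) :
    MemIntClosure (minorsIdeal 𝔽 m n t ^ s) (∏ i, δ i) := by
  set J := minorsIdeal 𝔽 m n t
  refine memIntClosure_of_forall_valuationSubring
    (IsFractionRing.injective _ (FractionRing (MvPolynomial (Fin m × Fin n) 𝔽))) _ _ fun V φ _ => ?_
  obtain ⟨d, hd, hA⟩ := Matrix.exists_mulEquivalent_rectDiag ((genMat 𝔽 m n).map φ)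
  have hd' : ∀ i j, i ≤ j → d i ∣ d j := fun i j hij =>
    Nat.le_induction dvd_rfl (fun k _ hk => hk.trans (hd k)) j hij
  have hdet : ∀ {k : ℕ} (r : Fin k → Fin m) (c : Fin k → Fin n),
      φ ((genMat 𝔽 m n).submatrix r c).det = (((genMat 𝔽 m n).map φ).submatrix r c).det :=
    fun r c => by rw [RingHom.map_det]; rfl
  have hdvd : ∀ i, ∏ j ∈ Finset.range (sz i), d j ∣ φ (δ i) := fun i => by
    obtain ⟨r, c, -, -, h⟩ := hminor i
    have h₁ := Matrix.det_submatrix_mem_detIdeal ((genMat 𝔽 m n).map φ) r c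
    rw [hA.detIdeal_eq] at h₁
    rw [h, hdet, ← Ideal.mem_span_singleton]
    exact Matrix.detIdeal_le_iff.2 (fun r c => Ideal.mem_span_singleton.2
      (Matrix.prod_dvd_det_submatrix_rectDiag hd' r c)) h₁
  have hmem : ∏ j ∈ Finset.range t, d j ∈ J.map φ := by
    have h₁ := Matrix.prod_mem_detIdeal_rectDiag htm (htm.trans hmn) d
    rw [← hA.detIdeal_eq] at h₁
    refine Matrix.detIdeal_le_iff.2 (fun r c => ?_) h₁
    rw [← hdet]
    exact Ideal.mem_map_of_mem φ (det_submatrix_genMat_mem_minorsIdeal 𝔽 r c)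
  rw [map_prod, Ideal.map_pow]
  exact Ideal.mem_of_dvd _ ((pow_prod_range_dvd_prod hd' ht hs hhs sz hdeg).trans
    (Finset.prod_dvd_prod_of_dvd _ _ fun i _ => hdvd i)) (Ideal.pow_mem_pow hmem s)
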